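/- arXiv:2109.05555 — 3 statements merged into one kernel-verified Lean document; each statement's English description precedes it below -/
import Mathlib

section
/- Let H be a finite group acting by ℂ-algebra automorphisms on a left noetherian unital ℂ-algebra A of at most countable dimension over ℂ, and let I be a two-sided ideal of A. Then PI.deg(A^H/(I ∩ A^H)) ≤ PI.deg(A/I) ≤ |H| · PI.deg(A^H/(I ∩ A^H)), where A^H is the fixed-point subalgebra and I ∩ A^H is a two-sided ideal of A^H. -/
/-- `f` in the free associative `ℤ`-algebra on countably many generators is a
polynomial identity of `A` if every substitution of elements of `A` for the
generators evaluates to `0`. -/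
def IsPolyId (A : Type*) [Ring A] (f : FreeAlgebra ℤ ℕ) : Prop :=
  ∀ φ : ℕ → A, FreeAlgebra.lift ℤ φ f = 0

/-- The PI degree of `A`: the supremum (in `ℕ∞`) of all `n ≥ 1` such that every
polynomial identity of `A` is a polynomial identity of `M_n(ℂ)`. -/
noncomputable def PIdeg (A : Type*) [Ring A] : ℕ∞ :=
  ⨆ m ∈ {m : ℕ | 1 ≤ m ∧ ∀ f : FreeAlgebra ℤ ℕ,
    IsPolyId A f → IsPolyId (Matrix (Fin m) (Fin m) ℂ) f}, (m : ℕ∞)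

/-- The fixed-point subring `A^H = {a ∈ A : h • a = a for all h ∈ H}` of a group (or
monoid) `H` acting on a ring `A` by ring automorphisms. -/
def fixedSubring (H : Type*) [Monoid H] (A : Type*) [Ring A] [MulSemiringAction H A] :
    Subring A where
  carrier := {a : A | ∀ h : H, h • a = a}
  zero_mem' := fun h => smul_zero h
  one_mem' := fun h => smul_one h
  add_mem' := fun ha hb h => by rw [smul_add, ha h, hb h]
  neg_mem' := fun ha h => by rw [smul_neg, ha h]
  mul_mem' := fun ha hb h => by rw [smul_mul', ha h, hb h]

/-- The intersection `I ∩ S` of a two-sided ideal `I` of `A` with a subring `S` of `A`,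
viewed as a two-sided ideal of `S`. -/
def TwoSidedIdeal.restrictSubring {A : Type*} [Ring A] (S : Subring A)
    (I : TwoSidedIdeal A) : TwoSidedIdeal S :=
  TwoSidedIdeal.mk' {x : S | (x : A) ∈ I}
    (by simpa using I.zero_mem)
    (fun hx hy => by simpa using I.add_mem hx hy)
    (fun hx => by simpa using I.neg_mem hx)
    (fun hy => by simpa using I.mul_mem_left _ _ hy)
    (fun hx => by simpa using I.mul_mem_right _ _ hx)

open Polynomial in
/-- If `a - c` is invertible for all scalars `c` in an uncountable set, then `a` is algebraic
as soon as the algebra has countable dimension. -/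
theorem isAlgebraic_of_rank_le_aleph0 {F R : Type*} [Field F] [Ring R] [Algebra F R]
    (hR : Module.rank F R ≤ Cardinal.aleph0) {T : Set F} (hT : ¬ T.Countable) {a : R}
    (ha : ∀ c ∈ T, IsUnit (a - algebraMap F R c)) : IsAlgebraic F a := by
  classical
  by_contra H
  rw [← Transcendental, transcendental_iff] at H
  choose! u hu using fun c hc => (ha c hc).exists_right_inv
  suffices hli : LinearIndependent F fun c : T => u c by
    refine hT (Set.countable_coe_iff.1 (Cardinal.mk_le_aleph0_iff.1 (Cardinal.lift_le_aleph0.1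
      (hli.cardinal_lift_le_rank.trans (Cardinal.lift_le_aleph0.2 hR)))))
  refine linearIndependent_iff'.2 fun s m hm i hi ↦ ?_
  let q (s : Finset T) : F[X] := ∏ j ∈ s, (X - C j.1)
  have h1 : ∀ j ∈ s, aeval a (q s) * u j = aeval a (q (s.erase j)) := fun j hj ↦ by
    simp only [q]
    rw [← s.prod_erase_mul _ hj, map_mul, mul_assoc]
    simp [hu j j.2]
  have h2 : ∑ j ∈ s, C (m j) * q (s.erase j) = 0 := by
    apply H
    have := congr(aeval a (q s) * $hm)
    simp_rw [mul_zero, Finset.mul_sum, mul_smul_comm] at this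
    rw [← this, map_sum]
    refine Finset.sum_congr rfl fun j hj => ?_
    rw [map_mul, aeval_C, h1 j hj, Algebra.smul_def]
  have h3 := congr(eval i.1 $h2)
  rw [eval_finsetSum, Finset.sum_eq_single_of_mem i hi, eval_mul, eval_C, eval_zero] at h3
  · refine (mul_eq_zero.1 h3).resolve_right ?_
    simp only [q, eval_prod, Finset.prod_ne_zero_iff]
    intro j hj
    have := (Finset.ne_of_mem_erase hj).symm
    simpa [sub_eq_zero, Subtype.ext_iff] using this
  · intro j hj hji
    have : i ∈ s.erase j := Finset.mem_erase_of_ne_of_mem hji.symm hi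
    simp [q, eval_mul, eval_prod, Finset.prod_eq_zero this]

theorem not_countable_compl_singleton_complex (c : ℂ) : ¬ ({c}ᶜ : Set ℂ).Countable := by
  intro h
  have := h.union (Set.countable_singleton c)
  rw [Set.compl_union_self] at this
  exact not_countable_complex this

theorem isUnit_one_add_of_mem_jacobson {R : Type*} [Ring R] {x : R} (hx : x ∈ Ring.jacobson R) :
    IsUnit (1 + x) := by
  have key : ∀ x ∈ Ring.jacobson R, ∃ z, z * (1 + x) = 1 := by
    intro x hx
    rw [← Ideal.jacobson_bot, Ideal.mem_jacobson_iff] at hx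
    obtain ⟨z, hz⟩ := hx 1
    refine ⟨z, ?_⟩
    rw [Ideal.mem_bot, sub_eq_zero] at hz
    rw [mul_one, add_comm] at hz
    rw [mul_add, mul_one, hz]
  obtain ⟨z, hz⟩ := key x hx
  obtain ⟨w, hw⟩ := key (-(z * x)) (neg_mem (Ideal.mul_mem_left _ _ hx))
  have hz' : 1 + -(z * x) = z := by rw [← hz]; noncomm_ring
  rw [hz'] at hw
  have : w = 1 + x := left_inv_eq_right_inv hw hz
  exact ⟨⟨1 + x, z, this ▸ hw, hz⟩, rfl⟩

open Polynomial in
/-- The Jacobson radical of a complex algebra of countable dimension is nil. -/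
theorem isNilpotent_of_mem_jacobson {R : Type*} [Ring R] [Algebra ℂ R]
    (hR : Module.rank ℂ R ≤ Cardinal.aleph0) {a : R} (ha : a ∈ Ring.jacobson R) :
    IsNilpotent a := by
  have hunit : ∀ (c : ℂ), c ≠ 0 → ∀ x ∈ Ring.jacobson R, IsUnit (algebraMap ℂ R c + x) := by
    intro c hc x hx
    have h1 : algebraMap ℂ R c + x = algebraMap ℂ R c * (1 + algebraMap ℂ R c⁻¹ * x) := by
      rw [mul_add, ← mul_assoc, ← map_mul, mul_inv_cancel₀ hc]; simp
    rw [h1]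
    exact ((isUnit_iff_ne_zero.2 hc).map _).mul
      (isUnit_one_add_of_mem_jacobson (Ideal.mul_mem_left _ _ hx))
  obtain ⟨p, hp, hpa⟩ := isAlgebraic_of_rank_le_aleph0 hR
    (not_countable_compl_singleton_complex 0) (a := a) (fun c hc => by
      have := hunit (-c) (neg_ne_zero.2 hc) a ha
      rwa [map_neg, neg_add_eq_sub] at this)
  obtain ⟨q, hq, hq0⟩ := exists_eq_pow_rootMultiplicity_mul_and_not_dvd p hp 0
  set k := p.rootMultiplicity 0
  refine ⟨k, ?_⟩
  have hq1 : q.coeff 0 ≠ 0 := by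
    simpa [X_dvd_iff] using hq0
  rw [hq] at hpa
  have hu : IsUnit (aeval a q) := by
    rw [← q.divX_mul_X_add, add_comm]
    simp only [map_add, aeval_C, map_mul, aeval_X]
    exact hunit _ hq1 _ (Ideal.mul_mem_left _ _ ha)
  simpa [hu.mul_left_eq_zero] using hpa

/-- Schur's lemma for simple modules of countable dimension. -/
theorem exists_eq_smul_of_isSimpleModule {R V : Type*} [Ring R] [Algebra ℂ R] [AddCommGroup V]
    [Module R V] [Module ℂ V] [IsScalarTower ℂ R V] [IsSimpleModule R V]
    (hV : Module.rank ℂ V ≤ Cardinal.aleph0) (g : Module.End R V) :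
    ∃ c : ℂ, ∀ v, g v = c • v := by
  classical
  by_contra! H
  have := IsSimpleModule.nontrivial R V
  obtain ⟨v, hv⟩ := exists_ne (0 : V)
  have hunit (c : ℂ) : IsUnit (g - algebraMap ℂ (Module.End R V) c) := by
    rw [isUnit_iff_ne_zero]
    intro h0
    obtain ⟨w, hw⟩ := H c
    apply hw
    have := congr($h0 w)
    simpa [sub_eq_zero] using this
  let ev : Module.End R V →ₗ[ℂ] V :=
    { toFun := fun f => f v, map_add' := fun _ _ => rfl, map_smul' := fun _ _ => rfl }
  have hev : Function.Injective ev := by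
    rw [injective_iff_map_eq_zero]
    intro f hf
    by_contra hne
    have : Function.Bijective f := LinearMap.bijective_of_ne_zero hne
    exact hv (this.1 (by simpa [ev] using hf))
  have hrank : Module.rank ℂ (Module.End R V) ≤ Cardinal.aleph0 := by
    have := LinearMap.rank_le_of_injective ev hev
    exact this.trans hV
  obtain ⟨p, hp, hpg⟩ := isAlgebraic_of_rank_le_aleph0 hrank
    (not_countable_compl_singleton_complex 0) (a := g) (fun c _ => hunit c)
  have key : IsUnit (Polynomial.aeval g p) := by
    rw [(IsAlgClosed.splits p).eq_prod_roots, map_mul, Polynomial.aeval_C]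
    refine ((isUnit_iff_ne_zero.2 (Polynomial.leadingCoeff_ne_zero.2 hp)).map _).mul ?_
    by_contra hn
    obtain ⟨k, hk, -⟩ := spectrum.exists_mem_of_not_isUnit_aeval_prod hn
    exact spectrum.mem_iff.1 hk (by simpa using (hunit k).neg)
  rw [hpg] at key
  exact not_isUnit_zero key

/-- **Levitzki's theorem**: a nil ideal of a left noetherian ring has bounded nilpotency index. -/
theorem Ideal.exists_forall_pow_eq_zero {R : Type*} [Ring R] [IsNoetherianRing R]
    (J : Ideal R) [J.IsTwoSided] (hJ : ∀ a ∈ J, IsNilpotent a) :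
    ∃ k, ∀ a ∈ J, a ^ k = 0 := by
  obtain ⟨N, ⟨hN2, k, hk⟩, hmax⟩ := set_has_maximal_iff_noetherian.2 ‹IsNoetherianRing R›
    {N : Ideal R | N.IsTwoSided ∧ ∃ k, ∀ a ∈ N, a ^ k = 0} ⟨⊥, inferInstance, 1, by simp⟩
  suffices hle : J ≤ N from ⟨k, fun a ha => hk a (hle ha)⟩
  by_contra hle
  obtain ⟨b, hbJ, hbN⟩ := SetLike.not_le_iff_exists.1 hle
  let L (a : R) : Ideal R := N.comap (LinearMap.toSpanSingleton R R a)
  have hL (a x : R) : x ∈ L a ↔ x * a ∈ N := Iff.rfl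
  obtain ⟨_, ⟨a, ⟨haJ, haN⟩, rfl⟩, ha⟩ := set_has_maximal_iff_noetherian.2 ‹IsNoetherianRing R›
    (Set.image L {a | a ∈ J ∧ a ∉ N}) ⟨_, b, ⟨hbJ, hbN⟩, rfl⟩
  have hann (u : R) (hu : a * u ∉ N) (x : R) (hx : x * (a * u) ∈ N) : x * a ∈ N := by
    have h1 := ha _ ⟨a * u, ⟨J.mul_mem_right _ haJ, hu⟩, rfl⟩
    have h2 : L a ≤ L (a * u) := fun y hy => by
      rw [hL, ← mul_assoc]; exact Ideal.mul_mem_right _ N hy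
    by_contra hxa
    exact h1 (lt_of_le_of_ne h2 fun h => hxa (by rw [← hL, h]; exact hx))
  have haua (u : R) : a * u * a ∈ N := by
    by_cases hu : a * u ∈ N
    · exact Ideal.mul_mem_right _ N hu
    obtain ⟨n, hn⟩ := hJ (a * u) (J.mul_mem_right _ haJ)
    have hex : ∃ n, (a * u) ^ (n + 1) ∈ N := ⟨n, by rw [pow_succ, hn, zero_mul]; exact N.zero_mem⟩
    classical
    obtain ⟨m, hm⟩ : ∃ m, Nat.find hex = m + 1 :=
      Nat.exists_eq_succ_of_ne_zero fun h => hu (by simpa [h] using Nat.find_spec hex)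
    have h1 := Nat.find_spec hex
    have h2 := Nat.find_min hex (m := m) (by omega)
    rw [hm, pow_succ'] at h1
    rw [pow_succ'] at h1 h2
    rw [mul_assoc a u] at h2
    exact hann _ h2 _ (by rwa [← mul_assoc a u])
  let T : Ideal R := Ideal.span {a} * ⊤
  have haT : a ∈ T := by
    simpa using Ideal.mul_mem_mul (Ideal.mem_span_singleton_self a)
      (Submodule.mem_top : (1 : R) ∈ ⊤)
  have hT : ∀ s ∈ T, ∀ y, a * y * s ∈ N := by
    let K : Ideal R :=
      { carrier := {s | ∀ y, a * y * s ∈ N}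
        zero_mem' := fun y => by simp
        add_mem' := fun hs ht y => by rw [mul_add]; exact N.add_mem (hs y) (ht y)
        smul_mem' := fun c s hs y => by
          rw [smul_eq_mul, ← mul_assoc, mul_assoc a]; exact hs _ }
    suffices T ≤ K from this
    refine Ideal.mul_le.2 fun r hr z _ y => ?_
    obtain ⟨c, rfl⟩ := Ideal.mem_span_singleton'.1 hr
    rw [← mul_assoc, ← mul_assoc, mul_assoc a]
    exact Ideal.mul_mem_right _ N (haua _)
  have hTT : ∀ s ∈ T, s * s ∈ N := by
    intro s hs
    suffices T ≤ N.comap (LinearMap.toSpanSingleton R R s) from this hs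
    refine Ideal.mul_le.2 fun r hr z _ => ?_
    obtain ⟨c, rfl⟩ := Ideal.mem_span_singleton'.1 hr
    change c * a * z * s ∈ N
    rw [mul_assoc c, mul_assoc c]
    exact Ideal.mul_mem_left N _ (hT s hs z)
  have hsup : Ideal.IsTwoSided (N ⊔ T) := ⟨fun b hx => by
    obtain ⟨n, hn, t, ht, rfl⟩ := Submodule.mem_sup.1 hx
    rw [add_mul]
    exact Submodule.add_mem_sup (Ideal.mul_mem_right _ N hn) (Ideal.mul_mem_right _ T ht)⟩
  refine hmax (N ⊔ T) ⟨hsup, 2 * k, fun x hx => ?_⟩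
    (lt_of_le_of_ne le_sup_left fun h => haN ?_)
  · obtain ⟨n, hn, t, ht, rfl⟩ := Submodule.mem_sup.1 hx
    rw [pow_mul]
    apply hk
    rw [sq, add_mul, mul_add n, mul_add t]
    exact N.add_mem (N.add_mem (Ideal.mul_mem_right _ N hn) (Ideal.mul_mem_right _ N hn))
      (N.add_mem (Ideal.mul_mem_left N _ hn) (hTT t ht))
  · rw [h]; exact Ideal.mem_sup_right haT

theorem map_lift_freeAlgebra {A B : Type*} [Ring A] [Ring B] (g : A →+* B) (φ : ℕ → A)
    (f : FreeAlgebra ℤ ℕ) :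
    g (FreeAlgebra.lift ℤ φ f) = FreeAlgebra.lift ℤ (fun i => g (φ i)) f := by
  have : g.toIntAlgHom.comp (FreeAlgebra.lift ℤ φ) = FreeAlgebra.lift ℤ (fun i => g (φ i)) := by
    ext i; simp
  exact congr($this f)

theorem IsPolyId.of_injective {A B : Type*} [Ring A] [Ring B] (g : A →+* B)
    (hg : Function.Injective g) {f : FreeAlgebra ℤ ℕ} (hf : IsPolyId B f) : IsPolyId A f := by
  intro φ
  apply hg
  rw [map_lift_freeAlgebra, hf, map_zero]

/-- The alternating sum `∑ σ, sign σ • x ^ σ(0) * y₀ * ⋯ * x ^ σ(m - 1) * yₘ₋₁`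
in the variables `x, y₀, …, yₘ₋₁`. -/
noncomputable def vandermondePoly (m : ℕ) : FreeAlgebra ℤ ℕ :=
  ∑ σ : Equiv.Perm (Fin m), Equiv.Perm.sign σ •
    (List.ofFn fun t : Fin m =>
      FreeAlgebra.ι ℤ 0 ^ (σ t : ℕ) * FreeAlgebra.ι ℤ ((t : ℕ) + 1)).prod

theorem lift_vandermondePoly {B : Type*} [Ring B] (m : ℕ) (φ : ℕ → B) :
    FreeAlgebra.lift ℤ φ (vandermondePoly m) =
      ∑ σ : Equiv.Perm (Fin m), Equiv.Perm.sign σ •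
        (List.ofFn fun t : Fin m => φ 0 ^ (σ t : ℕ) * φ (t + 1)).prod := by
  simp [vandermondePoly, Units.smul_def, map_list_prod, List.map_ofFn, Function.comp_def]

/-- Powers of an endomorphism are dependent by Cayley–Hamilton, so the alternating polynomial
`vandermondePoly m` vanishes in dimension less than `m`. -/
theorem isPolyId_vandermondePoly {V : Type*} [AddCommGroup V] [Module ℂ V] [Module.Finite ℂ V]
    {m : ℕ} (hm : Module.finrank ℂ V < m) : IsPolyId (Module.End ℂ V) (vandermondePoly m) := by
  intro φ
  let M : MultilinearMap ℂ (fun _ : Fin m => Module.End ℂ V) (Module.End ℂ V) :=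
    (MultilinearMap.mkPiAlgebraFin ℂ m (Module.End ℂ V)).compLinearMap
      fun t => LinearMap.mulRight ℂ (φ (t + 1))
  have h : FreeAlgebra.lift ℤ φ (vandermondePoly m) =
      MultilinearMap.alternatization M fun j : Fin m => φ 0 ^ (j : ℕ) := by
    rw [lift_vandermondePoly, MultilinearMap.alternatization_apply]
    simp [M]
  rw [h]
  apply AlternatingMap.map_linearDependent
  intro hli
  have hdeg := LinearMap.charpoly_natDegree (φ 0)
  have h0 := LinearMap.aeval_self_charpoly (φ 0)
  rw [Polynomial.aeval_eq_sum_range' (n := m) (by omega), Finset.sum_range] at h0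
  have h1 := Fintype.linearIndependent_iff.1 hli _ h0 ⟨_, hm⟩
  have h2 := (LinearMap.charpoly_monic (φ 0)).coeff_natDegree
  rw [hdeg] at h2
  simp [h2] at h1

theorem prod_ofFn_apply {V : Type*} [AddCommGroup V] [Module ℂ V] (n : ℕ)
    (A : Fin n → Module.End ℂ V) (c : Fin n → ℂ) (e : ℕ → V)
    (h : ∀ t : Fin n, A t (e (t + 1)) = c t • e t) :
    (List.ofFn A).prod (e n) = (∏ t, c t) • e 0 := by
  induction n generalizing e with
  | zero => simp
  | succ n ih =>
    have := ih (fun t => A t.succ) (fun t => c t.succ) (fun t => e (t + 1))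
      (fun t => by simpa using h t.succ)
    rw [List.ofFn_succ, List.prod_cons, Module.End.mul_apply, this, map_smul, Fin.prod_univ_succ]
    have h0 := h 0
    simp only [Fin.val_zero, zero_add] at h0 ⊢
    rw [h0, smul_smul, mul_comm]

/-- No power of `vandermondePoly m` is an identity of `m × m` matrices. -/
theorem not_isPolyId_vandermondePoly_pow {m : ℕ} (hm : 1 ≤ m) (k : ℕ) :
    ¬ IsPolyId (Matrix (Fin m) (Fin m) ℂ) (vandermondePoly m ^ k) := by
  intro H
  have : NeZero m := ⟨by omega⟩
  let e : ℕ → Fin m → ℂ := fun t => Pi.single (Fin.ofNat m t) 1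
  let x : Module.End ℂ (Fin m → ℂ) := Matrix.toLin' (Matrix.diagonal fun i => ((i : ℕ) : ℂ))
  let y : ℕ → Module.End ℂ (Fin m → ℂ) := fun t =>
    Matrix.toLin' (Matrix.single (Fin.ofNat m t) (Fin.ofNat m (t + 1)) 1)
  let φ : ℕ → Module.End ℂ (Fin m → ℂ) := fun i => Nat.casesOn i x y
  have hx (t j : ℕ) : (x ^ j) (e t) = (((Fin.ofNat m t : Fin m) : ℕ) : ℂ) ^ j • e t := by
    have h1 : x (e t) = (((Fin.ofNat m t : Fin m) : ℕ) : ℂ) • e t := by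
      ext i
      simp only [x, e, Matrix.toLin'_apply, Matrix.mulVec_diagonal, Pi.smul_apply, smul_eq_mul]
      rw [Pi.single_apply]
      by_cases hi : i = Fin.ofNat m t
      · simp [hi]
      · rw [if_neg hi, mul_zero, mul_zero]
    induction j with
    | zero => simp
    | succ j ih => rw [pow_succ, Module.End.mul_apply, h1, map_smul, ih, smul_smul, pow_succ']
  have hy (t : ℕ) : y t (e (t + 1)) = e t := by
    simp only [y, e, Matrix.toLin'_apply]
    rw [Matrix.mulVec_single_one]
    ext i
    simp [Matrix.single_apply, Pi.single_apply, eq_comm]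
  have hem : e m = e 0 := by simp [e]
  have hval : FreeAlgebra.lift ℤ φ (vandermondePoly m) (e 0) =
      (Matrix.vandermonde fun i : Fin m => ((i : ℕ) : ℂ)).det • e 0 := by
    rw [lift_vandermondePoly, LinearMap.sum_apply, ← Matrix.det_transpose, Matrix.det_apply,
      Finset.sum_smul]
    refine Finset.sum_congr rfl fun σ _ => ?_
    rw [LinearMap.smul_apply, smul_assoc]
    congr 1
    conv_lhs => rw [← hem]
    refine prod_ofFn_apply m _ _ e fun t => ?_
    rw [Module.End.mul_apply]
    change (x ^ _) (y t (e (t + 1))) = _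
    rw [hy, hx]
    simp [Matrix.vandermonde]
  have hdet : (Matrix.vandermonde fun i : Fin m => ((i : ℕ) : ℂ)).det ≠ 0 := by
    rw [Matrix.det_vandermonde_ne_zero_iff]
    exact Nat.cast_injective.comp Fin.val_injective
  have hpow (k : ℕ) : (FreeAlgebra.lift ℤ φ (vandermondePoly m) ^ k) (e 0) =
      (Matrix.vandermonde fun i : Fin m => ((i : ℕ) : ℂ)).det ^ k • e 0 := by
    induction k with
    | zero => simp
    | succ k ih => rw [pow_succ, Module.End.mul_apply, hval, map_smul, ih, smul_smul, pow_succ']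
  have hzero : FreeAlgebra.lift ℤ φ (vandermondePoly m ^ k) = 0 :=
    H.of_injective Matrix.toLinAlgEquiv'.symm.toRingEquiv.toRingHom
      Matrix.toLinAlgEquiv'.symm.injective φ
  have := congr($hzero (e 0))
  rw [map_pow, hpow, LinearMap.zero_apply, smul_eq_zero] at this
  refine this.elim (pow_ne_zero _ hdet) fun h => ?_
  simpa [e] using congr_fun h (Fin.ofNat m 0)

theorem exists_linearIndependent_of_lt_length {M : Type*} [AddCommGroup M] [Module ℂ M] {d : ℕ}
    (h : (d : ℕ∞) < Module.length ℂ M) : ∃ v : Fin (d + 1) → M, LinearIndependent ℂ v := by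
  rw [Module.length_eq_rank] at h
  have h2 : ((d + 1 : ℕ) : Cardinal) ≤ Module.rank ℂ M := by
    have := Order.add_one_le_of_lt h
    rw [← Cardinal.natCast_le_toENat]
    exact_mod_cast this
  obtain ⟨s, hs, hli⟩ := le_rank_iff_exists_linearIndependent_finset.1 h2
  exact ⟨fun i => (s.equivFinOfCardEq hs).symm i,
    (linearIndependent_equiv (s.equivFinOfCardEq hs).symm).2 hli⟩

theorem lift_smul_eq_map_lift_smul {S B M W : Type*} [Ring S] [Ring B] [AddCommGroup M]
    [AddCommGroup W] [Module S M] [Module B W] (L : W →+ M) {ψ : ℕ → S} {φ : ℕ → B}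
    (h : ∀ i w, ψ i • L w = L (φ i • w)) (g : FreeAlgebra ℤ ℕ) (w : W) :
    FreeAlgebra.lift ℤ ψ g • L w = L (FreeAlgebra.lift ℤ φ g • w) := by
  induction g using FreeAlgebra.induction generalizing w with
  | grade0 n => simp [Int.cast_smul_eq_zsmul]
  | grade1 i => simp [h]
  | mul a b ha hb => rw [map_mul, map_mul, mul_smul, hb, ha, mul_smul]
  | add a b ha hb => rw [map_add, map_add, add_smul, hb, ha, add_smul, map_add]

/-- If `f` evaluated on `S` annihilates a simple module of countable dimension, but `f` is not an
identity of `(d + 1) × (d + 1)` matrices, then the module has dimension at most `d`. -/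
theorem length_le_of_isSimpleModule {S M : Type*} [Ring S] [Algebra ℂ S] [AddCommGroup M]
    [Module S M] [Module ℂ M] [IsScalarTower ℂ S M] [IsSimpleModule S M]
    (hM : Module.rank ℂ M ≤ Cardinal.aleph0) {f : FreeAlgebra ℤ ℕ}
    (hf : ∀ (φ : ℕ → S) (w : M), FreeAlgebra.lift ℤ φ f • w = 0) {d : ℕ}
    (hd : ¬ IsPolyId (Matrix (Fin (d + 1)) (Fin (d + 1)) ℂ) f) :
    Module.length ℂ M ≤ d := by
  have : DecidableEq M := Classical.decEq M
  by_contra! hlt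
  obtain ⟨v, hv⟩ := exists_linearIndependent_of_lt_length hlt
  let L := Fintype.linearCombination ℂ v
  have hL : Function.Injective L := linearIndependent_iff_injective_fintypeLinearCombination.1 hv
  obtain ⟨p, hp⟩ := LinearMap.exists_leftInverse_of_injective L (LinearMap.ker_eq_bot.2 hL)
  have hpL (w) : p (L w) = w := congr($hp w)
  have hdense (X : Module.End ℂ (Fin (d + 1) → ℂ)) :
      ∃ s : S, ∀ w, s • L w = L (X w) := by
    let T : Module.End ℂ M := L ∘ₗ X ∘ₗ p
    let T' : Module.End (Module.End S M) M :=
      { toFun := T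
        map_add' := map_add T
        map_smul' := fun g m => by
          obtain ⟨c, hc⟩ := exists_eq_smul_of_isSimpleModule hM g
          simp [hc] }
    obtain ⟨s, hs⟩ := jacobson_density T' (Finset.univ.image v)
    refine ⟨s, fun w => ?_⟩
    have h1 : ∀ w, T (L w) = s • L w := by
      intro w
      have hL' : L w = ∑ i, w i • v i := rfl
      rw [hL', map_sum, Finset.smul_sum]
      refine Finset.sum_congr rfl fun i _ => ?_
      rw [map_smul, smul_comm]
      congr 1
      exact hs _ (Finset.mem_image_of_mem _ (Finset.mem_univ i))
    rw [← h1]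
    simp [T, hpL]
  choose ψ hψ using hdense
  refine hd (IsPolyId.of_injective (Matrix.toLinAlgEquiv' (R := ℂ)).toRingEquiv.toRingHom
    Matrix.toLinAlgEquiv'.injective fun φ => LinearMap.ext fun w => hL ?_)
  have h1 := lift_smul_eq_map_lift_smul (L : (Fin (d + 1) → ℂ) →+ M) (φ := φ)
    (ψ := fun i => ψ (φ i)) (fun i w => ?_) f w
  · exact h1.symm.trans ((hf _ _).trans (map_zero L).symm)
  · simp [hψ]

theorem length_le_mul_of_length_le {S : Type*} [Ring S] [Algebra ℂ S] {f : FreeAlgebra ℤ ℕ} {d : ℕ}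
    (hd : ¬ IsPolyId (Matrix (Fin (d + 1)) (Fin (d + 1)) ℂ) f) (n : ℕ)
    {M : Type*} [AddCommGroup M] [Module S M] [Module ℂ M] [IsScalarTower ℂ S M]
    (hM : Module.rank ℂ M ≤ Cardinal.aleph0)
    (hf : ∀ (φ : ℕ → S) (w : M), FreeAlgebra.lift ℤ φ f • w = 0)
    (hn : Module.length S M ≤ n) :
    Module.length ℂ M ≤ n * d := by
  induction n generalizing M with
  | zero =>
    have : Subsingleton M := Module.length_eq_zero_iff.1 (by simpa using hn)
    simp
  | succ n ih =>
    cases subsingleton_or_nontrivial M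
    · simp
    have hfin : IsFiniteLength S M :=
      Module.length_ne_top_iff.1 (ne_top_of_le_ne_top (ENat.natCast_ne_top _) hn)
    obtain ⟨hN, hA⟩ := isFiniteLength_iff_isNoetherian_isArtinian.1 hfin
    obtain ⟨N, hNatom⟩ := IsAtomic.exists_atom (Submodule S M)
    have : IsSimpleModule S N := isSimpleModule_iff_isAtom.2 hNatom
    have hlen := Module.length_eq_add_of_exact N.subtype N.mkQ N.subtype_injective
      N.mkQ_surjective (LinearMap.exact_subtype_mkQ N)
    have hlenC := Module.length_eq_add_of_exact (N.subtype.restrictScalars ℂ)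
      (N.mkQ.restrictScalars ℂ) N.subtype_injective N.mkQ_surjective (LinearMap.exact_subtype_mkQ N)
    have hq : Module.length S (M ⧸ N) ≤ n := by
      rw [Module.length_eq_one S N, add_comm] at hlen
      rw [hlen] at hn
      push_cast at hn
      exact (ENat.add_le_add_iff_right ENat.one_ne_top).1 hn
    have h1 : Module.length ℂ N ≤ d := by
      refine length_le_of_isSimpleModule (S := S) ?_ (fun φ w => Subtype.ext ?_) hd
      · exact (LinearMap.rank_le_of_injective (N.subtype.restrictScalars ℂ)
          N.subtype_injective).trans hM
      · exact hf φ w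
    have h2 : Module.length ℂ (M ⧸ N) ≤ n * d := by
      refine ih ?_ (fun φ w => ?_) hq
      · exact (LinearMap.rank_le_of_surjective (N.mkQ.restrictScalars ℂ)
          N.mkQ_surjective).trans hM
      · obtain ⟨w, rfl⟩ := N.mkQ_surjective w
        rw [← map_smul, hf, map_zero]
    rw [hlenC, add_comm]
    push_cast
    rw [add_mul, one_mul]
    exact add_le_add h2 h1

/-- The module `V` with the action of `R` twisted by `h`. -/
def Twist {H : Type*} (_ : H) (V : Type*) : Type _ := V

instance {H : Type*} (h : H) (V : Type*) [AddCommGroup V] : AddCommGroup (Twist h V) :=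
  inferInstanceAs (AddCommGroup V)

instance {H R : Type*} [Group H] [Ring R] [MulSemiringAction H R] (h : H) (V : Type*)
    [AddCommGroup V] [Module R V] : Module R (Twist h V) :=
  Module.compHom V (MulSemiringAction.toRingHom H R h)

section Twist

variable {H R V : Type*} [Group H] [Ring R] [MulSemiringAction H R] [AddCommGroup V] [Module R V]

/-- The identity map from the twisted module to the original one. -/
def Twist.toModule (h : H) (V : Type*) [AddCommGroup V] [Module R V] :
    Twist h V →ₛₗ[MulSemiringAction.toRingHom H R h] V where
  toFun v := v
  map_add' _ _ := rfl
  map_smul' _ _ := rfl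

theorem Twist.isSimpleModule (h : H) [IsSimpleModule R V] : IsSimpleModule R (Twist h V) := by
  have : RingHomSurjective (MulSemiringAction.toRingHom H R h) :=
    ⟨(MulSemiringAction.toRingEquiv H R h).surjective⟩
  exact (LinearMap.isSimpleModule_iff_of_bijective (Twist.toModule (R := R) h V)
    Function.bijective_id).2 ‹_›

/-- The diagonal embedding of `V` in the product of its twists. -/
def Twist.diag (H : Type*) (v : V) : (h : H) → Twist h V := fun _ => v

theorem Twist.toModule_diag (v : V) (h : H) :
    Twist.toModule (R := R) h V (Twist.diag H v h) = v :=
  rfl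

end Twist

/-- A simple module has length at most `|H|` over the fixed subalgebra of `H`. -/
theorem length_fixedPoints_le {H R V : Type*} [Group H] [Fintype H] [Ring R] [Algebra ℂ R]
    [MulSemiringAction H R] [SMulCommClass H ℂ R] [AddCommGroup V] [Module R V] [Module ℂ V]
    [IsScalarTower ℂ R V] [IsSimpleModule R V] :
    Module.length (FixedPoints.subalgebra ℂ R H) V ≤ Fintype.card H := by
  have hlen : Module.length R ((h : H) → Twist h V) = Fintype.card H := by
    have (h : H) : IsSimpleModule R (Twist h V) := Twist.isSimpleModule h
    simp [Module.length_pi_of_fintype, Module.length_eq_one]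
  rw [← hlen, ← WithBot.coe_le_coe, Module.coe_length, Module.coe_length]
  let F (N : Submodule (FixedPoints.subalgebra ℂ R H) V) : Submodule R ((h : H) → Twist h V) :=
    Submodule.span R (Set.image (Twist.diag H) (N : Set V))
  have hmono : Monotone F := fun N N' h => Submodule.span_mono (Set.image_mono h)
  have hback (N : Submodule (FixedPoints.subalgebra ℂ R H) V) (v : V)
      (hv : Twist.diag H v ∈ F N) : v ∈ N := by
    have hsum : ∀ w ∈ F N, ∀ r : R, ∑ h : H, (h • r) • Twist.toModule (R := R) h V (w h) ∈ N := by
      intro w hw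
      induction hw using Submodule.span_induction with
      | mem w hw =>
        obtain ⟨n, hn, rfl⟩ := hw
        intro r
        have hr : ∑ h : H, h • r ∈ FixedPoints.subalgebra ℂ R H := fun g => by
          simp_rw [Finset.smul_sum, smul_smul]
          exact Fintype.sum_equiv (Equiv.mulLeft g) _ _ fun h => rfl
        simp_rw [Twist.toModule_diag, ← Finset.sum_smul]
        exact N.smul_mem ⟨_, hr⟩ hn
      | zero => intro r; simp
      | add w w' _ _ hw hw' =>
        intro r
        simp_rw [Pi.add_apply, map_add, smul_add, Finset.sum_add_distrib]
        exact N.add_mem (hw r) (hw' r)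
      | smul s w _ hw =>
        intro r
        simpa [smul_mul', mul_smul] using hw (r * s)
    have h1 := hsum _ hv 1
    have h2 : ∑ h : H, (h • (1 : R)) • Twist.toModule (R := R) h V (Twist.diag H v h) =
        (Fintype.card H : ℂ) • v := by
      simp [Twist.toModule_diag, Nat.cast_smul_eq_nsmul]
    rw [h2] at h1
    have h3 := N.smul_of_tower_mem (Fintype.card H : ℂ)⁻¹ h1
    rwa [smul_smul, inv_mul_cancel₀ (by simp), one_smul] at h3
  refine Order.krullDim_le_of_strictMono F (hmono.strictMono_of_injective fun N N' h => ?_)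
  have (N N' : Submodule (FixedPoints.subalgebra ℂ R H) V) (h : F N = F N') : N ≤ N' :=
    fun v hv => hback N' v (h ▸ Submodule.subset_span ⟨v, hv, rfl⟩)
  exact le_antisymm (this _ _ h) (this _ _ h.symm)

theorem TwoSidedIdeal.mk'_eq_zero_iff {A : Type*} [Ring A] (I : TwoSidedIdeal A) (a : A) :
    I.ringCon.mk' a = 0 ↔ a ∈ I := by
  rw [TwoSidedIdeal.mem_iff, ← RingCon.eq]
  rfl

theorem isPolyId_quotient_iff {A : Type*} [Ring A] (I : TwoSidedIdeal A) (f : FreeAlgebra ℤ ℕ) :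
    IsPolyId I.ringCon.Quotient f ↔ ∀ φ : ℕ → A, FreeAlgebra.lift ℤ φ f ∈ I := by
  constructor
  · intro h φ
    rw [← I.mk'_eq_zero_iff, map_lift_freeAlgebra]
    exact h _
  · intro h φ
    choose ψ hψ using fun i => I.ringCon.mk'_surjective (φ i)
    obtain rfl : (fun i => I.ringCon.mk' (ψ i)) = φ := funext hψ
    rw [← map_lift_freeAlgebra, I.mk'_eq_zero_iff]
    exact h ψ

theorem isPolyId_quotient_restrictSubring_iff {A : Type*} [Ring A] (S : Subring A)
    (I : TwoSidedIdeal A) (f : FreeAlgebra ℤ ℕ) :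
    IsPolyId (I.restrictSubring S).ringCon.Quotient f ↔
      ∀ φ : ℕ → A, (∀ i, φ i ∈ S) → FreeAlgebra.lift ℤ φ f ∈ I := by
  have hmem (x : S) : x ∈ I.restrictSubring S ↔ (x : A) ∈ I := by
    simp [TwoSidedIdeal.restrictSubring]
  rw [isPolyId_quotient_iff]
  simp_rw [hmem, ← S.subtype_apply, map_lift_freeAlgebra]
  exact ⟨fun h φ hφ => h fun i => ⟨φ i, hφ i⟩, fun h φ => h _ fun i => (φ i).2⟩

theorem PIdeg_mono {A B : Type*} [Ring A] [Ring B]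
    (h : ∀ f, IsPolyId B f → IsPolyId A f) : PIdeg A ≤ PIdeg B :=
  iSup₂_le fun m hm => le_iSup₂_of_le m ⟨hm.1, fun f hf => hm.2 f (h f hf)⟩ le_rfl

/-- If `f` vanishes modulo `I` on the fixed points of `H` and is not an identity of
`(d + 1) × (d + 1)` matrices, then the polynomial `vandermondePoly m` with `|H| * d < m` takes
values in the maximal left ideals containing `I`. -/
theorem lift_vandermondePoly_mem {H A : Type*} [Group H] [Fintype H] [Ring A] [Algebra ℂ A]
    [MulSemiringAction H A] [SMulCommClass H ℂ A] (hcount : Module.rank ℂ A ≤ Cardinal.aleph0)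
    (I : TwoSidedIdeal A) {f : FreeAlgebra ℤ ℕ} {d m : ℕ}
    (hf : ∀ φ : ℕ → A, (∀ i, φ i ∈ fixedSubring H A) → FreeAlgebra.lift ℤ φ f ∈ I)
    (hd : ¬ IsPolyId (Matrix (Fin (d + 1)) (Fin (d + 1)) ℂ) f) (hm : Fintype.card H * d < m)
    (J : Ideal A) [hJ : J.IsMaximal] (hIJ : ∀ x ∈ I, x ∈ J) (φ : ℕ → A) :
    FreeAlgebra.lift ℤ φ (vandermondePoly m) ∈ J := by
  have hI (x : A) (hx : x ∈ I) (v : A ⧸ J) : x • v = 0 := by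
    obtain ⟨a, rfl⟩ := J.mkQ_surjective v
    rw [← map_smul]
    exact (Submodule.Quotient.mk_eq_zero J).2 (hIJ _ (I.mul_mem_right _ _ hx))
  have : IsSimpleModule A (A ⧸ J) := isSimpleModule_iff_isCoatom.2 hJ.out
  have hlen : Module.length ℂ (A ⧸ J) ≤ (Fintype.card H : ℕ) * d := by
    refine length_le_mul_of_length_le (S := FixedPoints.subalgebra ℂ A H) hd _ ?_ (fun ψ v => ?_)
      length_fixedPoints_le
    · exact (LinearMap.rank_le_of_surjective (J.mkQ.restrictScalars ℂ) J.mkQ_surjective).trans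
        hcount
    · have h1 := hI _ (hf (fun i => ψ i) fun i => (ψ i).2) v
      have h2 := map_lift_freeAlgebra (FixedPoints.subalgebra ℂ A H).val.toRingHom ψ f
      exact congr($h2 • v).trans h1
  have hfin : Module.Finite ℂ (A ⧸ J) := by
    have := Module.length_ne_top_iff.1 (ne_top_of_le_ne_top (ENat.natCast_ne_top _)
      (hlen.trans_eq (Nat.cast_mul _ _).symm))
    have := (isFiniteLength_iff_isNoetherian_isArtinian.1 this).1
    infer_instance
  rw [Module.length_eq_finrank] at hlen
  have h0 := isPolyId_vandermondePoly (V := A ⧸ J) (m := m)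
    (lt_of_le_of_lt (by exact_mod_cast hlen) hm) (fun i => Module.toModuleEnd ℂ (A ⧸ J) (φ i))
  have h1 := lift_smul_eq_map_lift_smul (AddMonoidHom.id (A ⧸ J)) (ψ := φ)
    (φ := fun i => Module.toModuleEnd ℂ (A ⧸ J) (φ i)) (fun i w => rfl) (vandermondePoly m)
    (J.mkQ 1)
  rw [h0, zero_smul, map_zero, AddMonoidHom.id_apply, ← map_smul, smul_eq_mul, mul_one] at h1
  exact (Submodule.Quotient.mk_eq_zero J).1 h1

/-- Let `H` be a finite group acting by `ℂ`-algebra automorphisms on a left noetherian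
unital `ℂ`-algebra `A` of at most countable dimension over `ℂ`, and let `I` be a
two-sided ideal of `A`.  Then
`PI.deg(A^H/(I ∩ A^H)) ≤ PI.deg(A/I) ≤ |H| · PI.deg(A^H/(I ∩ A^H))`. -/
theorem stmt8 (H : Type*) [Group H] [Fintype H]
    (A : Type*) [Ring A] [Algebra ℂ A] [MulSemiringAction H A] [SMulCommClass H ℂ A]
    (hcount : Module.rank ℂ A ≤ Cardinal.aleph0)
    [IsNoetherianRing A]
    (I : TwoSidedIdeal A) :
    PIdeg (I.restrictSubring (fixedSubring H A)).ringCon.Quotient ≤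
        PIdeg I.ringCon.Quotient ∧
      PIdeg I.ringCon.Quotient ≤ (Fintype.card H : ℕ∞) *
        PIdeg (I.restrictSubring (fixedSubring H A)).ringCon.Quotient := by
  constructor
  · refine PIdeg_mono fun f hf => ?_
    rw [isPolyId_quotient_iff] at hf
    exact (isPolyId_quotient_restrictSubring_iff _ _ _).2 fun φ _ => hf φ
  generalize hD : PIdeg (I.restrictSubring (fixedSubring H A)).ringCon.Quotient = D
  induction D using ENat.recTopCoe with
  | top => simp
  | coe d =>
  obtain ⟨f, hf, hfd⟩ : ∃ f, IsPolyId (I.restrictSubring (fixedSubring H A)).ringCon.Quotient f ∧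
      ¬ IsPolyId (Matrix (Fin (d + 1)) (Fin (d + 1)) ℂ) f := by
    by_contra! h
    have : ((d + 1 : ℕ) : ℕ∞) ≤ d := by
      rw [← hD]
      exact le_iSup₂_of_le (d + 1) ⟨by omega, h⟩ le_rfl
    exact absurd (Nat.cast_le.1 this) (by omega)
  rw [isPolyId_quotient_restrictSubring_iff] at hf
  refine iSup₂_le fun m ⟨hm1, hm⟩ => ?_
  by_contra! hlt
  replace hlt : Fintype.card H * d < m := by exact_mod_cast hlt
  have hsurj := I.ringCon.mk'_surjective
  have : IsNoetherianRing I.ringCon.Quotient := isNoetherianRing_of_surjective _ _ _ hsurj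
  have hrank : Module.rank ℂ I.ringCon.Quotient ≤ Cardinal.aleph0 := by
    let π : A →ₗ[ℂ] I.ringCon.Quotient :=
      { toFun := I.ringCon.mk', map_add' := map_add _, map_smul' := fun _ _ => rfl }
    exact (LinearMap.rank_le_of_surjective π hsurj).trans hcount
  obtain ⟨k, hk⟩ := (Ring.jacobson I.ringCon.Quotient).exists_forall_pow_eq_zero
    fun a ha => isNilpotent_of_mem_jacobson hrank ha
  refine not_isPolyId_vandermondePoly_pow hm1 k (hm _ fun φ => ?_)
  rw [map_pow]
  apply hk
  choose ψ hψ using fun i => hsurj (φ i)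
  obtain rfl : (fun i => I.ringCon.mk' (ψ i)) = φ := funext hψ
  rw [← map_lift_freeAlgebra, Ring.jacobson_eq_sInf_isMaximal, Submodule.mem_sInf]
  intro (J : Ideal I.ringCon.Quotient) (hJ : J.IsMaximal)
  have : (J.comap I.ringCon.mk').IsMaximal := Ideal.comap_isMaximal_of_surjective _ hsurj
  refine lift_vandermondePoly_mem hcount I hf hfd hlt (J.comap I.ringCon.mk') (fun x hx => ?_) ψ
  rw [Ideal.mem_comap, (I.mk'_eq_zero_iff x).2 hx]
  exact J.zero_mem
end

section
/- Let A be a left noetherian unital ℂ-algebra of at most countable dimension over ℂ. Then dim_ℂ(A) ≤ L · PI.deg(A)², where L ∈ ℕ ∪ {∞} is the length of A as a bimodule over itself, i.e. the supremum of the lengths of strictly increasing chains of two-sided ideals of A. In particular, if L and PI.deg(A) are both finite, then A is finite dimensional. -/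
/-- The length of `A` as a bimodule over itself: the supremum in `ℕ∞` of the lengths of
strictly increasing chains of two-sided ideals of `A`. -/
noncomputable def bimoduleLength (A : Type*) [Ring A] : ℕ∞ :=
  sSup {n : ℕ∞ | ∃ (m : ℕ) (c : Fin (m + 1) → TwoSidedIdeal A),
    StrictMono c ∧ n = (m : ℕ∞)}

open Polynomial in
theorem isUnit_aeval_of_spectrum_eq_empty {F D : Type*} [Field F] [IsAlgClosed F] [Ring D]
    [Algebra F D] {x : D} (hx : spectrum F x = ∅) {p : F[X]} (hp : p ≠ 0) :
    IsUnit (aeval x p) := by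
  by_contra h
  have h0 : (0 : F) ∈ spectrum F (aeval x p) := by rwa [spectrum.zero_mem_iff]
  rcases lt_or_ge 0 p.degree with hd | hd
  · rw [spectrum.map_polynomial_aeval_of_degree_pos x p hd, hx] at h0
    simp at h0
  · rw [eq_C_of_degree_le_zero hd, aeval_C] at h
    refine h ((IsUnit.mk0 _ fun h' => hp ?_).map _)
    rw [eq_C_of_degree_le_zero hd, h', C_0]

open Polynomial in
theorem linearIndependent_inverse_sub_of_spectrum_eq_empty {F D : Type*} [Field F] [IsAlgClosed F]
    [Ring D] [Nontrivial D] [Algebra F D] {x : D} (hx : spectrum F x = ∅) :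
    LinearIndependent F fun a : F ↦ Ring.inverse (x - algebraMap F D a) := by
  classical
  refine linearIndependent_iff'.2 fun s m hm i hi ↦ ?_
  have hunit (a : F) : IsUnit (x - algebraMap F D a) := by
    simpa using isUnit_aeval_of_spectrum_eq_empty hx (X_sub_C_ne_zero a)
  let p : F[X] := ∑ j ∈ s, C (m j) * ∏ k ∈ s.erase j, (X - C k)
  have hp : aeval x p = 0 := by
    have h := congr(aeval x (∏ k ∈ s, (X - C k)) * $hm)
    rw [mul_zero, Finset.mul_sum] at h
    rw [← h, map_sum]
    refine Finset.sum_congr rfl fun j hj ↦ ?_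
    rw [← s.prod_erase_mul _ hj, map_mul, map_mul, aeval_C, mul_smul_comm, mul_assoc,
      map_sub, aeval_X, aeval_C, Ring.mul_inverse_cancel _ (hunit j), mul_one, Algebra.smul_def]
  have hp0 : p = 0 := by
    by_contra h
    exact (isUnit_aeval_of_spectrum_eq_empty hx h).ne_zero hp
  have he := congr(eval i $hp0)
  rw [eval_finsetSum, Finset.sum_eq_single_of_mem i hi, eval_zero, eval_mul, eval_C] at he
  · refine (mul_eq_zero.1 he).resolve_right ?_
    rw [eval_prod]
    refine Finset.prod_ne_zero_iff.2 fun k hk ↦ ?_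
    simpa [sub_eq_zero] using (Finset.ne_of_mem_erase hk).symm
  · intro j _ hji
    rw [eval_mul, eval_prod, Finset.prod_eq_zero (Finset.mem_erase.2 ⟨hji.symm, hi⟩) (by simp),
      mul_zero]

/-- Amitsur's lemma: over `ℂ`, elements of nontrivial algebras of at most countable dimension have
nonempty spectrum. -/
theorem spectrum_nonempty_of_rank_le_aleph0 {D : Type*} [Ring D] [Nontrivial D] [Algebra ℂ D]
    (hD : Module.rank ℂ D ≤ Cardinal.aleph0) (x : D) : (spectrum ℂ x).Nonempty := by
  rw [Set.nonempty_iff_ne_empty]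
  intro hx
  have h := (linearIndependent_inverse_sub_of_spectrum_eq_empty hx).cardinal_lift_le_rank
  rw [Cardinal.mk_complex, Cardinal.lift_continuum] at h
  have h' := Cardinal.lift_le.2 hD
  rw [Cardinal.lift_aleph0] at h'
  exact (h.trans h').not_gt Cardinal.aleph0_lt_continuum

section SimpleModule

variable {A V : Type*} [Ring A] [Algebra ℂ A] [AddCommGroup V] [Module ℂ V] [Module A V]
  [IsScalarTower ℂ A V] [IsSimpleModule A V]

theorem exists_eq_smul_of_isSimpleModule_of_rank_le_aleph0
    (hV : Module.rank ℂ V ≤ Cardinal.aleph0) (g : Module.End A V) :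
    ∃ c : ℂ, ∀ v, g v = c • v := by
  classical
  have : Nontrivial V := IsSimpleModule.nontrivial A V
  obtain ⟨v, hv⟩ := exists_ne (0 : V)
  let ev : Module.End A V →ₗ[ℂ] V :=
    { toFun := fun g ↦ g v
      map_add' := fun _ _ ↦ rfl
      map_smul' := fun _ _ ↦ rfl }
  have hev : Function.Injective ev := by
    rw [injective_iff_map_eq_zero]
    intro g hg
    by_contra hne
    exact hv ((LinearMap.bijective_of_ne_zero hne).1 (by simpa [ev] using hg))
  have hrank : Module.rank ℂ (Module.End A V) ≤ Cardinal.aleph0 :=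
    (LinearMap.rank_le_of_injective ev hev).trans hV
  obtain ⟨c, hc⟩ := spectrum_nonempty_of_rank_le_aleph0 hrank g
  refine ⟨c, fun w ↦ ?_⟩
  rw [spectrum.mem_iff] at hc
  have h0 : algebraMap ℂ (Module.End A V) c - g = 0 := by
    by_contra hne
    exact hc (isUnit_iff_ne_zero.2 hne)
  have := LinearMap.congr_fun h0 w
  rw [LinearMap.sub_apply, LinearMap.zero_apply, sub_eq_zero] at this
  exact this.symm

theorem exists_smul_eq_of_linearIndependent (hV : Module.rank ℂ V ≤ Cardinal.aleph0)
    {n : ℕ} {v : Fin n → V} (hv : LinearIndependent ℂ v) (u : Fin n → V) :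
    ∃ a : A, ∀ k, a • v k = u k := by
  classical
  obtain ⟨f, hf⟩ : ∃ f : V →ₗ[ℂ] V, ∀ k, f (v k) = u k := by
    obtain ⟨f, hf⟩ := ((Module.Basis.span hv).constr ℂ u).exists_extend
    refine ⟨f, fun k ↦ ?_⟩
    have := LinearMap.congr_fun hf (Module.Basis.span hv k)
    rw [Module.Basis.constr_basis] at this
    simpa [Module.Basis.span_apply] using this
  let f' : Module.End (Module.End A V) V :=
    { toFun := f
      map_add' := f.map_add
      map_smul' := fun g w ↦ by
        obtain ⟨c, hc⟩ := exists_eq_smul_of_isSimpleModule_of_rank_le_aleph0 hV g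
        simp [hc] }
  obtain ⟨a, ha⟩ := jacobson_density f' (Finset.univ.image v)
  refine ⟨a, fun k ↦ ?_⟩
  rw [← hf, ← ha (v k) (by simp)]
  rfl

theorem isPolyId_matrix_of_linearIndependent (hV : Module.rank ℂ V ≤ Cardinal.aleph0)
    {n : ℕ} {v : Fin n → V} (hv : LinearIndependent ℂ v) {f : FreeAlgebra ℤ ℕ}
    (hf : IsPolyId A f) : IsPolyId (Matrix (Fin n) (Fin n) ℂ) f := by
  intro φ
  choose a ha using fun i ↦
    exists_smul_eq_of_linearIndependent (A := A) hV hv fun k ↦ ∑ l, φ i l k • v l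
  have key : ∀ (g : FreeAlgebra ℤ ℕ) (k : Fin n),
      FreeAlgebra.lift ℤ a g • v k = ∑ l, FreeAlgebra.lift ℤ φ g l k • v l := by
    intro g
    induction g using FreeAlgebra.induction with
    | grade0 r =>
      intro k
      simp only [AlgHom.commutes]
      simp [algebraMap_int_eq, Matrix.intCast_apply, ite_smul, Int.cast_smul_eq_zsmul]
    | grade1 i => simpa using ha i
    | add x y hx hy =>
      intro k
      simp [add_smul, hx, hy, Finset.sum_add_distrib]
    | mul x y hx hy =>
      intro k
      simp only [map_mul, mul_smul, hy, Finset.smul_sum, Matrix.mul_apply, Finset.sum_smul]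
      rw [Finset.sum_comm]
      refine Finset.sum_congr rfl fun l _ ↦ ?_
      rw [smul_algebra_smul_comm, hx, Finset.smul_sum]
      simp [smul_smul, mul_comm]
  ext l k
  have h := key f k
  rw [hf a, zero_smul, eq_comm] at h
  exact Fintype.linearIndependent_iff.1 hv _ h l

end SimpleModule

theorem natCast_le_PIdeg {A : Type*} [Ring A] {n : ℕ}
    (h : ∀ f, IsPolyId A f → IsPolyId (Matrix (Fin n) (Fin n) ℂ) f) : (n : ℕ∞) ≤ PIdeg A := by
  rcases Nat.eq_zero_or_pos n with rfl | hn
  · simp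
  · exact le_iSup₂ (f := fun (m : ℕ) (_ : m ∈ {m : ℕ | 1 ≤ m ∧ ∀ f : FreeAlgebra ℤ ℕ,
      IsPolyId A f → IsPolyId (Matrix (Fin m) (Fin m) ℂ) f}) ↦ (m : ℕ∞)) n ⟨hn, h⟩

theorem finrank_le_PIdeg_of_isSimpleModule (A : Type*) {V : Type*} [Ring A] [Algebra ℂ A]
    [AddCommGroup V] [Module ℂ V] [Module A V] [IsScalarTower ℂ A V] [IsSimpleModule A V]
    (hV : Module.rank ℂ V ≤ Cardinal.aleph0) (hA : PIdeg A ≠ ⊤) :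
    FiniteDimensional ℂ V ∧ (Module.finrank ℂ V : ℕ∞) ≤ PIdeg A := by
  have bound : ∀ {n : ℕ} {v : Fin n → V}, LinearIndependent ℂ v → (n : ℕ∞) ≤ PIdeg A :=
    fun hv ↦ natCast_le_PIdeg fun _ ↦ isPolyId_matrix_of_linearIndependent hV hv
  have fin : FiniteDimensional ℂ V := by
    by_contra hinf
    rw [FiniteDimensional, ← Module.rank_lt_aleph0_iff, not_lt] at hinf
    obtain ⟨d, hd⟩ := ENat.ne_top_iff_exists.1 hA
    obtain ⟨v, hv⟩ := exists_linearIndependent_of_le_rank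
      (R := ℂ) (M := V) (n := d + 1) (Cardinal.natCast_lt_aleph0.le.trans hinf)
    have := bound hv
    rw [← hd] at this
    norm_cast at this
    omega
  exact ⟨fin, bound (Module.finBasis ℂ V).linearIndependent⟩

theorem IsPolyId.of_surjective {A B : Type*} [Ring A] [Ring B] (π : A →+* B)
    (hπ : Function.Surjective π) {f : FreeAlgebra ℤ ℕ} (hf : IsPolyId A f) : IsPolyId B f := by
  intro φ
  choose a ha using fun i ↦ hπ (φ i)
  have : FreeAlgebra.lift ℤ φ = π.toIntAlgHom.comp (FreeAlgebra.lift ℤ a) := by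
    ext i
    simp [ha]
  simp [this, hf a]

theorem PIdeg_le_of_surjective {A B : Type*} [Ring A] [Ring B] (π : A →+* B)
    (hπ : Function.Surjective π) : PIdeg B ≤ PIdeg A :=
  iSup₂_le fun _ hm ↦ natCast_le_PIdeg fun f hf ↦ hm.2 f (hf.of_surjective π hπ)

theorem unop_map_eq_lift_star {A : Type*} [Ring A] (φ : ℕ → A) (g : FreeAlgebra ℤ ℕ →+* Aᵐᵒᵖ)
    (hg : ∀ i, g (FreeAlgebra.ι ℤ i) = MulOpposite.op (φ i)) (f : FreeAlgebra ℤ ℕ) :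
    (g f).unop = FreeAlgebra.lift ℤ φ (star f) := by
  induction f using FreeAlgebra.induction with
  | grade0 r => simp
  | grade1 i => simp [hg]
  | add x y hx hy => simp [hx, hy]
  | mul x y hx hy => simp [hx, hy]

theorem isPolyId_mulOpposite_iff {A : Type*} [Ring A] {f : FreeAlgebra ℤ ℕ} :
    IsPolyId Aᵐᵒᵖ f ↔ IsPolyId A (star f) := by
  refine ⟨fun h φ ↦ ?_, fun h φ ↦ MulOpposite.unop_injective ?_⟩
  · refine (unop_map_eq_lift_star φ _ (fun i ↦ FreeAlgebra.lift_ι_apply _ i) f).symm.trans ?_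
    exact congrArg MulOpposite.unop (h fun i ↦ MulOpposite.op (φ i))
  · exact (unop_map_eq_lift_star (fun i ↦ (φ i).unop) _
      (fun i ↦ FreeAlgebra.lift_ι_apply φ i) f).trans (h _)

theorem PIdeg_mulOpposite_le (A : Type*) [Ring A] : PIdeg Aᵐᵒᵖ ≤ PIdeg A := by
  refine iSup₂_le fun m hm ↦ natCast_le_PIdeg fun f hf ↦ ?_
  have h := hm.2 (star f) (by rwa [isPolyId_mulOpposite_iff, star_star])
  rw [← isPolyId_mulOpposite_iff] at h
  let e := (Matrix.transposeRingEquiv (Fin m) ℂ).symm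
  exact h.of_surjective e.toRingHom e.surjective

theorem finiteDimensional_range_of_le_ker {K E F : Type*} [Field K] [AddCommGroup E] [Module K E]
    [AddCommGroup F] [Module K F] (f : E →ₗ[K] F) (N : Submodule K E) [FiniteDimensional K (E ⧸ N)]
    (h : N ≤ LinearMap.ker f) : FiniteDimensional K (LinearMap.range f) := by
  rw [← Submodule.range_liftQ N f h]
  infer_instance

theorem finiteDimensional_of_mul_self_eq_bot {K A : Type*} [Field K] [Ring A] [Algebra K A]
    (I : Ideal A) [FiniteDimensional K (A ⧸ I.restrictScalars K)] (hfg : I.FG)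
    (hI : ∀ x ∈ I, ∀ y ∈ I, x * y = 0) : FiniteDimensional K (I.restrictScalars K) := by
  classical
  obtain ⟨S, hS⟩ := hfg
  let R : A → Submodule K A := fun g ↦ LinearMap.range (LinearMap.mulRight K g)
  have hR : ∀ g ∈ S, FiniteDimensional K (R g) := fun g hg ↦
    finiteDimensional_range_of_le_ker _ (I.restrictScalars K) fun x hx ↦
      hI x hx g (hS ▸ Submodule.subset_span hg)
  have : FiniteDimensional K (⨆ g : S, R g : Submodule K A) := by
    have : ∀ g : S, FiniteDimensional K (R g) := fun g ↦ hR g g.2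
    infer_instance
  refine Submodule.finiteDimensional_of_le (S₂ := ⨆ g : S, R g) fun x hx ↦ ?_
  rw [Submodule.restrictScalars_mem, ← hS] at hx
  induction hx using Submodule.span_induction with
  | mem x hx => exact Submodule.mem_iSup_of_mem (⟨x, hx⟩ : S) ⟨1, by simp⟩
  | zero => exact zero_mem _
  | add x y _ _ hx hy => exact add_mem hx hy
  | smul a x hx' hx =>
    clear hx'
    induction hx using Submodule.iSup_induction' with
    | mem g x hx =>
      obtain ⟨b, rfl⟩ := hx
      exact Submodule.mem_iSup_of_mem g ⟨a * b, by simp [mul_assoc]⟩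
    | zero => simp
    | add x y _ _ hx hy => rw [smul_add]; exact add_mem hx hy

/-- A minimal two-sided ideal that is not contained in the Jacobson radical is finite dimensional
over `ℂ` if the algebra has countable dimension and finite PI degree. -/
theorem finiteDimensional_of_not_le_jacobson {A : Type*} [Ring A] [Algebra ℂ A]
    (hcount : Module.rank ℂ A ≤ Cardinal.aleph0) (hA : PIdeg A ≠ ⊤) {M : TwoSidedIdeal A}
    (hM : IsAtom M) (hJ : ¬ M.asIdeal ≤ Ring.jacobson A) :
    FiniteDimensional ℂ (M.asIdeal.restrictScalars ℂ) := by
  rw [Ring.jacobson_eq_sInf_isMaximal, le_sInf_iff] at hJ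
  push Not at hJ
  obtain ⟨m, hm : m.IsMaximal, hMm⟩ := hJ
  have : IsSimpleModule A (A ⧸ m) := isSimpleModule_iff_isCoatom.2 hm.out
  have hV : Module.rank ℂ (A ⧸ m) ≤ Cardinal.aleph0 :=
    (LinearMap.rank_le_of_surjective (m.mkQ.restrictScalars ℂ) m.mkQ_surjective).trans hcount
  obtain ⟨_, -⟩ := finrank_le_PIdeg_of_isSimpleModule A hV hA
  let ρ : A →ₗ[ℂ] Module.End ℂ (A ⧸ m) := (Algebra.lsmul ℂ ℂ (A ⧸ m)).toLinearMap
  have hdisj : M ⊓ (Module.annihilator A (A ⧸ m)).toTwoSided = ⊥ := by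
    rcases hM.le_iff.1 (inf_le_left : M ⊓ (Module.annihilator A (A ⧸ m)).toTwoSided ≤ M)
      with h | h
    · exact h
    · refine (hMm fun x hx ↦ ?_).elim
      have hx' : x ∈ (Module.annihilator A (A ⧸ m)).toTwoSided :=
        (inf_eq_left.1 h) (TwoSidedIdeal.mem_asIdeal.1 hx)
      rw [Ideal.mem_toTwoSided, Module.mem_annihilator] at hx'
      have := hx' (Submodule.Quotient.mk 1)
      rwa [← Submodule.Quotient.mk_smul, smul_eq_mul, mul_one,
        Submodule.Quotient.mk_eq_zero] at this
  refine Module.Finite.of_injective (ρ.domRestrict (M.asIdeal.restrictScalars ℂ)) ?_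
  rw [injective_iff_map_eq_zero]
  rintro ⟨x, hx⟩ h
  have hx' : x ∈ M ⊓ (Module.annihilator A (A ⧸ m)).toTwoSided := by
    refine ⟨TwoSidedIdeal.mem_asIdeal.1 hx, ?_⟩
    change x ∈ (Module.annihilator A (A ⧸ m)).toTwoSided
    rw [Ideal.mem_toTwoSided, Module.mem_annihilator]
    exact fun v ↦ LinearMap.congr_fun h v
  rw [hdisj, TwoSidedIdeal.mem_bot] at hx'
  exact Subtype.ext hx'

theorem finiteDimensional_of_le_jacobson {A : Type*} [Ring A] [Algebra ℂ A] [IsNoetherianRing A]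
    {M : TwoSidedIdeal A} (hM : IsAtom M) (hJ : M.asIdeal ≤ Ring.jacobson A)
    [FiniteDimensional ℂ (A ⧸ M.asIdeal.restrictScalars ℂ)] :
    FiniteDimensional ℂ (M.asIdeal.restrictScalars ℂ) := by
  have hfg : M.asIdeal.FG := IsNoetherian.noetherian _
  refine finiteDimensional_of_mul_self_eq_bot M.asIdeal hfg fun x hx y hy ↦ ?_
  rcases hM.le_iff.1 (show (M.asIdeal * M.asIdeal).toTwoSided ≤ M from fun z hz ↦
    TwoSidedIdeal.mem_asIdeal.1 (Ideal.mul_le_right (Ideal.mem_toTwoSided.1 hz))) with h | h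
  · have : x * y ∈ (M.asIdeal * M.asIdeal).toTwoSided :=
      Ideal.mem_toTwoSided.2 (Ideal.mul_mem_mul hx hy)
    rwa [h, TwoSidedIdeal.mem_bot] at this
  · have h0 : M.asIdeal = ⊥ := by
      refine Submodule.FG.eq_bot_of_le_jacobson_smul hfg fun z hz ↦ ?_
      have hz' : z ∈ (M.asIdeal * M.asIdeal).toTwoSided := by
        rw [h]
        exact TwoSidedIdeal.mem_asIdeal.1 hz
      have hz'' : z ∈ M.asIdeal * M.asIdeal := Ideal.mem_toTwoSided.1 hz'
      exact Submodule.smul_mono_left hJ hz''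
    rw [h0] at hx
    rw [(Submodule.mem_bot A).1 hx, zero_mul]

/-- A minimal two-sided ideal of a finite-dimensional algebra has dimension at most the square of
the PI degree. -/
theorem finrank_le_sq_of_isAtom {A : Type*} [Ring A] [Algebra ℂ A] [FiniteDimensional ℂ A] {d : ℕ}
    (hd : PIdeg A ≤ d) {M : TwoSidedIdeal A} (hM : IsAtom M) :
    Module.finrank ℂ (M.asIdeal.restrictScalars ℂ) ≤ d ^ 2 := by
  have hMb : M.asIdeal ≠ ⊥ := fun h ↦ hM.1 <| by
    rw [← Ideal.toTwoSided_asIdeal M]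
    ext x
    simp [h]
  have : IsArtinianRing A := IsArtinianRing.of_finite ℂ A
  obtain ⟨V, hV, hVM⟩ := (eq_bot_or_exists_atom_le M.asIdeal).resolve_left hMb
  have : IsSimpleModule A V := isSimpleModule_iff_isAtom.2 hV
  have : IsScalarTower ℂ Aᵐᵒᵖ A := ⟨fun c a x ↦ by simp⟩
  have : FiniteDimensional ℂ (V →ₗ[A] A) :=
    .of_injective (LinearMap.restrictScalarsₗ ℂ A V A ℂ) (LinearMap.restrictScalars_injective _)
  have : IsArtinian Aᵐᵒᵖ (V →ₗ[A] A) := isArtinian_of_tower ℂ inferInstance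
  let H : Submodule Aᵐᵒᵖ (V →ₗ[A] A) :=
    { carrier := {h | ∀ v, h v ∈ M.asIdeal}
      add_mem' := fun h₁ h₂ v ↦ add_mem (h₁ v) (h₂ v)
      zero_mem' := fun v ↦ zero_mem _
      smul_mem' := fun a h hh v ↦ M.mul_mem_right _ _ (hh v) }
  have hHb : H ≠ ⊥ := by
    intro h
    have hmem : V.subtype ∈ H := fun v ↦ hVM v.2
    rw [h, Submodule.mem_bot] at hmem
    exact hV.1 (by rw [← Submodule.range_subtype V, hmem, LinearMap.range_zero])
  obtain ⟨W, hW, hWH⟩ := (eq_bot_or_exists_atom_le H).resolve_left hHb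
  have : IsSimpleModule Aᵐᵒᵖ W := isSimpleModule_iff_isAtom.2 hW
  have hVd : Module.finrank ℂ V ≤ d := by
    have := (finrank_le_PIdeg_of_isSimpleModule A (V := V) (Module.rank_lt_aleph0 ℂ V).le
      (ne_top_of_le_ne_top (ENat.natCast_ne_top d) hd)).2.trans hd
    exact_mod_cast this
  have : FiniteDimensional ℂ W :=
    inferInstanceAs (FiniteDimensional ℂ (W.restrictScalars ℂ))
  have hWd : Module.finrank ℂ W ≤ d := by
    have hd' := (PIdeg_mulOpposite_le A).trans hd
    have := (finrank_le_PIdeg_of_isSimpleModule Aᵐᵒᵖ (V := W) (Module.rank_lt_aleph0 ℂ W).le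
      (ne_top_of_le_ne_top (ENat.natCast_ne_top d) hd')).2.trans hd'
    exact_mod_cast this
  let Φ : TensorProduct ℂ W V →ₗ[ℂ] A :=
    TensorProduct.lift ((LinearMap.restrictScalarsₗ ℂ A V A ℂ).comp (W.subtype.restrictScalars ℂ))
  have hΦ : ∀ (w : W) (v : V), Φ (w ⊗ₜ[ℂ] v) = w.1 v := fun w v ↦ rfl
  let N : TwoSidedIdeal A := TwoSidedIdeal.mk' (LinearMap.range Φ : Set A) (zero_mem _)
    (fun hx hy ↦ add_mem hx hy) (fun hx ↦ neg_mem hx)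
    (by
      rintro a _ ⟨t, rfl⟩
      induction t with
      | zero => simp
      | add x y hx hy =>
        rw [map_add, mul_add]
        exact add_mem hx hy
      | tmul w v => exact ⟨w ⊗ₜ (a • v), by simp [hΦ]⟩)
    (by
      rintro _ a ⟨t, rfl⟩
      induction t with
      | zero => simp
      | add x y hx hy =>
        rw [map_add, add_mul]
        exact add_mem hx hy
      | tmul w v => exact ⟨(MulOpposite.op a • w) ⊗ₜ v, by simp [hΦ]⟩)
  have hN : ∀ x, x ∈ N ↔ x ∈ LinearMap.range Φ := fun x ↦ TwoSidedIdeal.mem_mk' ..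
  have hNM : N ≤ M := by
    intro x hx
    obtain ⟨t, rfl⟩ := (hN x).1 hx
    clear hx
    induction t with
    | zero => simp [M.zero_mem]
    | add x y hx hy =>
      rw [map_add]
      exact M.add_mem hx hy
    | tmul w v => exact hWH w.2 v
  have hNeq : N = M := by
    refine (hM.le_iff.1 hNM).resolve_left fun h ↦ ?_
    refine hW.1 ((Submodule.eq_bot_iff _).2 fun w hw ↦ LinearMap.ext fun v ↦ ?_)
    have : w v ∈ N := (hN _).2 ⟨(⟨w, hw⟩ : W) ⊗ₜ v, rfl⟩
    rwa [h, TwoSidedIdeal.mem_bot] at this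
  have hle : M.asIdeal.restrictScalars ℂ ≤ LinearMap.range Φ := fun x hx ↦
    (hN x).1 (hNeq ▸ TwoSidedIdeal.mem_asIdeal.1 hx)
  have : Module.Free ℂ W := .of_divisionRing ℂ W
  calc Module.finrank ℂ (M.asIdeal.restrictScalars ℂ)
      ≤ Module.finrank ℂ (LinearMap.range Φ) := Submodule.finrank_mono hle
    _ ≤ Module.finrank ℂ (TensorProduct ℂ W V) := LinearMap.finrank_range_le Φ
    _ = Module.finrank ℂ W * Module.finrank ℂ V := Module.finrank_tensorProduct ..
    _ ≤ d * d := Nat.mul_le_mul hWd hVd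
    _ = d ^ 2 := (sq d).symm

theorem natCast_le_bimoduleLength {A : Type*} [Ring A] {m : ℕ} (c : Fin (m + 1) → TwoSidedIdeal A)
    (hc : StrictMono c) : (m : ℕ∞) ≤ bimoduleLength A :=
  le_sSup ⟨m, c, hc, rfl⟩

theorem one_le_bimoduleLength (A : Type*) [Ring A] [Nontrivial A] : 1 ≤ bimoduleLength A :=
  natCast_le_bimoduleLength (m := 1) ![⊥, ⊤] (by simp [Fin.strictMono_iff_lt_succ])

theorem isAtomic_twoSidedIdeal_of_bimoduleLength_ne_top {A : Type*} [Ring A]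
    (hA : bimoduleLength A ≠ ⊤) : IsAtomic (TwoSidedIdeal A) := by
  obtain ⟨d, hd⟩ := ENat.ne_top_iff_exists.1 hA
  refine isAtomic_of_orderBot_wellFounded_lt ?_
  rw [wellFounded_iff_isEmpty_descending_chain]
  refine ⟨fun ⟨f, hf⟩ ↦ ?_⟩
  have hanti : StrictAnti f := strictAnti_nat_of_succ_lt hf
  have := natCast_le_bimoduleLength (m := d + 1) (fun i ↦ f (Fin.rev i))
    fun i j hij ↦ hanti (Fin.rev_lt_rev.2 hij)
  rw [← hd] at this
  norm_cast at this
  omega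

theorem bimoduleLength_quotient_add_one_le {A : Type*} [Ring A] {M : TwoSidedIdeal A}
    (hM : ⊥ < M) : bimoduleLength (A ⧸ M.asIdeal) + 1 ≤ bimoduleLength A := by
  rcases eq_or_ne (bimoduleLength A) ⊤ with h | h
  · simp [h]
  let π := Ideal.Quotient.mk M.asIdeal
  have key : ∀ (m : ℕ) (c : Fin (m + 1) → TwoSidedIdeal (A ⧸ M.asIdeal)), StrictMono c →
      ((m + 1 : ℕ) : ℕ∞) ≤ bimoduleLength A := by
    intro m c hc
    have hmono : StrictMono fun i ↦ (c i).comap π := by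
      refine (TwoSidedIdeal.comap π).monotone.strictMono_of_injective ?_ |>.comp hc
      intro I J hIJ
      ext x
      obtain ⟨a, rfl⟩ := Ideal.Quotient.mk_surjective x
      rw [← TwoSidedIdeal.mem_comap, ← TwoSidedIdeal.mem_comap]
      exact iff_of_eq congr(a ∈ $hIJ)
    refine natCast_le_bimoduleLength (Fin.cons ⊥ fun i ↦ (c i).comap π) ?_
    rw [Fin.strictMono_iff_lt_succ]
    intro i
    refine Fin.cases ?_ (fun j ↦ ?_) i
    · refine hM.trans_le fun x hx ↦ ?_
      change x ∈ (c 0).comap π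
      rw [TwoSidedIdeal.mem_comap, Ideal.Quotient.eq_zero_iff_mem.2 (TwoSidedIdeal.mem_asIdeal.2 hx)]
      exact (c 0).zero_mem
    · exact hmono j.castSucc_lt_succ
  obtain ⟨l, hl⟩ := ENat.ne_top_iff_exists.1 h
  rw [← hl] at key ⊢
  have hl1 : 1 ≤ l := by exact_mod_cast key 0 (fun _ ↦ ⊥) fun i j hij ↦ by omega
  have hle : bimoduleLength (A ⧸ M.asIdeal) ≤ (l - 1 : ℕ) := by
    refine sSup_le ?_
    rintro _ ⟨m, c, hc, rfl⟩
    have := key m c hc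
    norm_cast at this ⊢
    omega
  calc bimoduleLength (A ⧸ M.asIdeal) + 1 ≤ ((l - 1 : ℕ) : ℕ∞) + 1 := by gcongr
    _ = l := by norm_cast; omega

theorem finiteDimensional_and_finrank_le.{u} (n d : ℕ) : ∀ (A : Type u) [Ring A] [Algebra ℂ A]
    [IsNoetherianRing A], Module.rank ℂ A ≤ Cardinal.aleph0 → bimoduleLength A ≤ n → PIdeg A ≤ d →
    FiniteDimensional ℂ A ∧ Module.finrank ℂ A ≤ n * d ^ 2 := by
  induction n with
  | zero =>
    intro A _ _ _ _ hL _
    have : Subsingleton A := by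
      by_contra hA
      rw [not_subsingleton_iff_nontrivial] at hA
      simpa using (one_le_bimoduleLength A).trans hL
    exact ⟨inferInstance, by simp [Module.finrank_zero_of_subsingleton]⟩
  | succ n ih =>
    intro A _ _ _ hcount hL hd
    rcases subsingleton_or_nontrivial A with _ | _
    · exact ⟨inferInstance, by simp [Module.finrank_zero_of_subsingleton]⟩
    have : IsAtomic (TwoSidedIdeal A) := isAtomic_twoSidedIdeal_of_bimoduleLength_ne_top
      (ne_top_of_le_ne_top (ENat.natCast_ne_top _) hL)
    obtain ⟨M, hM⟩ := IsAtomic.exists_atom (TwoSidedIdeal A)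
    have hLQ : bimoduleLength (A ⧸ M.asIdeal) ≤ n := by
      have := (bimoduleLength_quotient_add_one_le hM.bot_lt).trans hL
      rw [Nat.cast_add, Nat.cast_one] at this
      exact (ENat.add_le_add_iff_right ENat.one_ne_top).1 this
    have hcQ : Module.rank ℂ (A ⧸ M.asIdeal) ≤ Cardinal.aleph0 :=
      (LinearMap.rank_le_of_surjective (M.asIdeal.mkQ.restrictScalars ℂ)
        M.asIdeal.mkQ_surjective).trans hcount
    have hdQ : PIdeg (A ⧸ M.asIdeal) ≤ d :=
      (PIdeg_le_of_surjective _ Ideal.Quotient.mk_surjective).trans hd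
    have : IsNoetherianRing (A ⧸ M.asIdeal) :=
      isNoetherianRing_of_surjective _ _ (Ideal.Quotient.mk M.asIdeal) Ideal.Quotient.mk_surjective
    obtain ⟨hQ, hQd⟩ := ih (A ⧸ M.asIdeal) hcQ hLQ hdQ
    have e : (A ⧸ M.asIdeal.restrictScalars ℂ) ≃ₗ[ℂ] (A ⧸ M.asIdeal) :=
      Submodule.Quotient.restrictScalarsEquiv ℂ M.asIdeal
    have : FiniteDimensional ℂ (A ⧸ M.asIdeal.restrictScalars ℂ) := e.symm.finiteDimensional
    have hMfin : FiniteDimensional ℂ (M.asIdeal.restrictScalars ℂ) := by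
      by_cases hJ : M.asIdeal ≤ Ring.jacobson A
      · exact finiteDimensional_of_le_jacobson hM hJ
      · exact finiteDimensional_of_not_le_jacobson hcount
          (ne_top_of_le_ne_top (ENat.natCast_ne_top d) hd) hM hJ
    have hAfin : FiniteDimensional ℂ A :=
      Module.Finite.of_submodule_quotient (M.asIdeal.restrictScalars ℂ)
    refine ⟨hAfin, ?_⟩
    rw [← Submodule.finrank_quotient_add_finrank (M.asIdeal.restrictScalars ℂ), e.finrank_eq,
      Nat.succ_mul]
    exact Nat.add_le_add hQd (finrank_le_sq_of_isAtom hd hM)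

theorem one_le_PIdeg (A : Type*) [Ring A] [Algebra ℂ A] [Nontrivial A] : 1 ≤ PIdeg A := by
  refine natCast_le_PIdeg (n := 1) fun f hf φ ↦ ?_
  let e : ℂ →+* Matrix (Fin 1) (Fin 1) ℂ := Matrix.scalar (Fin 1)
  have he : Function.Surjective e := fun x ↦ ⟨x 0 0, by ext i j; fin_cases i; fin_cases j; rfl⟩
  have hfC : IsPolyId ℂ f := by
    intro ψ
    have h := hf fun i ↦ algebraMap ℂ A (ψ i)
    have hcomp : FreeAlgebra.lift ℤ (fun i ↦ algebraMap ℂ A (ψ i)) =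
        (algebraMap ℂ A).toIntAlgHom.comp (FreeAlgebra.lift ℤ ψ) := by
      ext i
      simp
    rw [hcomp] at h
    exact (algebraMap ℂ A).injective (h.trans (map_zero _).symm)
  exact hfC.of_surjective e he φ

/-- Let `A` be a left noetherian unital `ℂ`-algebra of at most countable dimension over
`ℂ`.  Then `dim_ℂ(A) ≤ L · PI.deg(A)²`, where `L` is the length of `A` as a bimodule
over itself.  In particular, if both `L` and `PI.deg(A)` are finite, then `A` is finite
dimensional. -/
theorem stmt9 (A : Type*) [Ring A] [Algebra ℂ A]
    (hcount : Module.rank ℂ A ≤ Cardinal.aleph0)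
    [IsNoetherianRing A] :
    Cardinal.toENat (Module.rank ℂ A) ≤ bimoduleLength A * (PIdeg A) ^ 2 ∧
      (bimoduleLength A ≠ ⊤ → PIdeg A ≠ ⊤ → FiniteDimensional ℂ A) := by
  have key (hL : bimoduleLength A ≠ ⊤) (hd : PIdeg A ≠ ⊤) : FiniteDimensional ℂ A ∧
      (Module.finrank ℂ A : ℕ∞) ≤ bimoduleLength A * (PIdeg A) ^ 2 := by
    obtain ⟨l, hl⟩ := ENat.ne_top_iff_exists.1 hL
    obtain ⟨d, hd⟩ := ENat.ne_top_iff_exists.1 hd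
    obtain ⟨hfin, hle⟩ := finiteDimensional_and_finrank_le l d A hcount hl.ge hd.ge
    rw [← hl, ← hd]
    exact ⟨hfin, by exact_mod_cast hle⟩
  refine ⟨?_, fun hL hd ↦ (key hL hd).1⟩
  rcases subsingleton_or_nontrivial A with _ | _
  · simp [rank_subsingleton']
  have hd0 : PIdeg A ≠ 0 := (one_pos.trans_le (one_le_PIdeg A)).ne'
  have hL0 : bimoduleLength A ≠ 0 := (one_pos.trans_le (one_le_bimoduleLength A)).ne'
  rcases eq_or_ne (bimoduleLength A) ⊤ with hL | hL
  · rw [hL, ENat.top_mul (pow_ne_zero 2 hd0)]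
    exact le_top
  rcases eq_or_ne (PIdeg A) ⊤ with hd | hd
  · rw [hd, sq, ENat.top_mul ENat.top_ne_zero, ENat.mul_top hL0]
    exact le_top
  obtain ⟨hfin, hle⟩ := key hL hd
  rwa [← Module.finrank_eq_rank, Cardinal.toENat_nat]
end

section
/- Let A be a unital ℂ-algebra of at most countable dimension over ℂ and suppose n := PI.deg(A) is finite. Then p_n(a, b; b^n) lies in the Jacobson radical J(A) for all a, b ∈ A. -/
universe u

/-- The iterated commutator expressions `p_i(X, Y; Z)` of the paper:
`p₁(X,Y;Z) = [Z,X] = ZX - XZ` and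
`p_i(X,Y;Z) = [p_{i-1}(X,Y;Z), p_{i-1}(X,Y;Y^{i-1})]` for `i ≥ 2`. -/
def pComm {R : Type*} [Ring R] (X Y : R) : ℕ → R → R
  | 0, Z => Z
  | 1, Z => Z * X - X * Z
  | (i + 2), Z =>
      pComm X Y (i + 1) Z * pComm X Y (i + 1) (Y ^ (i + 1)) -
        pComm X Y (i + 1) (Y ^ (i + 1)) * pComm X Y (i + 1) Z

open Polynomial in
/-- If an endomorphism of a vector space over an algebraically closed field has empty spectrum,
the solutions `w c` of `(f - c) w = v`, for a fixed nonzero `v`, are linearly independent. -/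
theorem linearIndependent_of_spectrum_eq_empty {K V : Type*} [Field K] [IsAlgClosed K]
    [AddCommGroup V] [Module K V] (f : Module.End K V) (hf : spectrum K f = ∅)
    {v : V} (hv : v ≠ 0) (w : K → V) (hw : ∀ c, f (w c) - c • w c = v) :
    LinearIndependent K w := by
  classical
  have key : ∀ p : K[X], aeval f p v = 0 → p = 0 := by
    intro p hp
    by_contra hp0
    have hu : IsUnit (aeval f (Multiset.map (fun x ↦ X - C x) p.roots).prod) := by
      by_contra h
      obtain ⟨k, hk, -⟩ := spectrum.exists_mem_of_not_isUnit_aeval_prod h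
      simp [hf] at hk
    have hinj := ((Module.End.isUnit_iff _).1 hu).injective
    rw [(IsAlgClosed.splits p).eq_prod_roots, map_mul, aeval_C, Module.End.mul_apply,
      Module.algebraMap_end_apply] at hp
    have h0 := (smul_eq_zero.1 hp).resolve_left (leadingCoeff_ne_zero.2 hp0)
    exact hv (hinj (h0.trans (map_zero _).symm))
  rw [linearIndependent_iff']
  intro s g hg i hi
  have hP : (∑ k ∈ s, C (g k) * ∏ j ∈ s.erase k, (X - C j) : K[X]) = 0 := by
    apply key
    have hk : ∀ k ∈ s, aeval f (C (g k) * ∏ j ∈ s.erase k, (X - C j)) v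
        = aeval f (∏ j ∈ s, (X - C j)) (g k • w k) := by
      intro k hk
      rw [← s.prod_erase_mul _ hk, map_mul, map_mul, aeval_C, Module.End.mul_apply,
        Module.End.mul_apply, Module.algebraMap_end_apply]
      simp [← hw k, smul_sub]
    rw [map_sum, LinearMap.sum_apply, Finset.sum_congr rfl hk, ← map_sum, hg, map_zero]
  have he := congrArg (eval i) hP
  rw [eval_finsetSum, Finset.sum_eq_single_of_mem i hi] at he
  · rw [eval_mul, eval_C, eval_prod, eval_zero, mul_eq_zero, Finset.prod_eq_zero_iff] at he
    refine he.resolve_right ?_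
    rintro ⟨j, hj, h⟩
    simp only [eval_sub, eval_X, eval_C, sub_eq_zero] at h
    exact (Finset.mem_erase.1 hj).1 h.symm
  · intro k _ hki
    rw [eval_mul, eval_prod, Finset.prod_eq_zero (Finset.mem_erase.2 ⟨hki.symm, hi⟩), mul_zero]
    simp

/-- Schur's lemma for complex algebras of countable dimension. -/
theorem exists_end_eq_smul_of_rank_le_aleph0 {A V : Type*} [Ring A] [Algebra ℂ A]
    [AddCommGroup V] [Module A V] [Module ℂ V] [IsScalarTower ℂ A V] [IsSimpleModule A V]
    (hA : Module.rank ℂ A ≤ Cardinal.aleph0) (f : Module.End A V) :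
    ∃ c : ℂ, ∀ v, f v = c • v := by
  by_contra! hne
  have hbij : ∀ c : ℂ, Function.Bijective (f - algebraMap ℂ (Module.End A V) c) := by
    intro c
    refine LinearMap.bijective_of_ne_zero fun h ↦ ?_
    obtain ⟨v, hv⟩ := hne c
    have := LinearMap.congr_fun h v
    simp [sub_eq_zero] at this
    exact hv this
  have := IsSimpleModule.nontrivial A V
  obtain ⟨v, hv⟩ := exists_ne (0 : V)
  choose w hw using fun c ↦ (hbij c).surjective v
  have hli : LinearIndependent ℂ w := by
    refine linearIndependent_of_spectrum_eq_empty (f.restrictScalars ℂ) ?_ hv w ?_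
    · rw [Set.eq_empty_iff_forall_notMem]
      intro c hc
      rw [spectrum.mem_iff, ← IsUnit.neg_iff, neg_sub] at hc
      exact hc ((Module.End.isUnit_iff _).2 (hbij c))
    · intro c
      simpa using hw c
  have hV :=
    LinearMap.lift_rank_le_of_surjective ((LinearMap.toSpanSingleton A V v).restrictScalars ℂ)
      (IsSimpleModule.toSpanSingleton_surjective A hv)
  have h1 := hli.cardinal_lift_le_rank
  rw [Cardinal.mk_complex, Cardinal.lift_continuum] at h1
  have h2 : Module.rank ℂ V ≤ Cardinal.aleph0 := by
    rw [← Cardinal.lift_le_aleph0]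
    exact hV.trans (Cardinal.lift_le_aleph0.2 hA)
  have h3 := h1.trans (Cardinal.lift_le_aleph0.2 h2)
  exact absurd h3 (not_le.2 Cardinal.aleph0_lt_continuum)

/-- A simple module containing `m` linearly independent vectors forces every polynomial identity
of `A` to hold in `M_m(ℂ)`. -/
theorem isPolyId_matrix_of_linearIndependent_s10 {A V : Type*} [Ring A] [Algebra ℂ A]
    [AddCommGroup V] [Module A V] [Module ℂ V] [IsScalarTower ℂ A V] [IsSimpleModule A V]
    (hA : Module.rank ℂ A ≤ Cardinal.aleph0) {m : ℕ} {e : Fin m → V}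
    (he : LinearIndependent ℂ e) {f : FreeAlgebra ℤ ℕ} (hf : IsPolyId A f) :
    IsPolyId (Matrix (Fin m) (Fin m) ℂ) f := by
  classical
  have dense : ∀ M : Matrix (Fin m) (Fin m) ℂ, ∃ r : A, ∀ j, r • e j = ∑ i, M i j • e i := by
    intro M
    obtain ⟨g, hg⟩ := ((Module.Basis.span he).constr ℂ
      (fun j ↦ ∑ i, M i j • e i)).exists_extend
    have hge : ∀ j, g (e j) = ∑ i, M i j • e i := by
      intro j
      have h := LinearMap.congr_fun hg (Module.Basis.span he j)
      rw [Module.Basis.constr_basis] at h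
      simpa [Module.Basis.span_apply] using h
    let g' : Module.End (Module.End A V) V :=
      { toFun := g
        map_add' := g.map_add
        map_smul' := fun d x ↦ by
          obtain ⟨c, hc⟩ := exists_end_eq_smul_of_rank_le_aleph0 hA d
          simp [hc] }
    obtain ⟨r, hr⟩ := jacobson_density g' (Finset.univ.image e)
    refine ⟨r, fun j ↦ ?_⟩
    rw [← hr (e j) (by simp), ← hge j]
    rfl
  intro φ
  choose ψ hψ using fun k ↦ dense (φ k)
  have key : ∀ x : FreeAlgebra ℤ ℕ, ∀ j,
      FreeAlgebra.lift ℤ ψ x • e j = ∑ i, (FreeAlgebra.lift ℤ φ x) i j • e i := by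
    intro x
    induction x using FreeAlgebra.induction with
    | grade0 r =>
      intro j
      simp [Matrix.intCast_apply, Int.cast_smul_eq_zsmul, ite_smul]
    | grade1 k => simpa using hψ k
    | mul x y hx hy =>
      intro j
      rw [map_mul, map_mul, mul_smul, hy, Finset.smul_sum]
      simp only [Matrix.mul_apply, Finset.sum_smul]
      rw [Finset.sum_comm]
      refine Finset.sum_congr rfl fun i _ ↦ ?_
      rw [← algebraMap_smul A, smul_smul, ← Algebra.commutes, mul_smul, hx, algebraMap_smul,
        Finset.smul_sum]
      exact Finset.sum_congr rfl fun k _ ↦ by rw [smul_smul, mul_comm]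
    | add x y hx hy =>
      intro j
      simp [add_smul, hx, hy, Finset.sum_add_distrib]
  ext i j
  have h := key f j
  rw [hf ψ, zero_smul] at h
  exact Fintype.linearIndependent_iff.1 he _ h.symm i

theorem map_pComm {R S : Type*} [Ring R] [Ring S] (f : R →+* S) (X Y : R) :
    ∀ (i : ℕ) (Z : R), f (pComm X Y i Z) = pComm (f X) (f Y) i (f Z)
  | 0, Z => rfl
  | 1, Z => by simp [pComm]
  | i + 2, Z => by simp [pComm, map_pComm f X Y (i + 1)]

theorem exists_linearMap_eq_pComm (K : Type*) {R : Type*} [CommRing K] [Ring R] [Algebra K R]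
    (X Y : R) : ∀ i : ℕ, ∃ L : R →ₗ[K] R, ∀ Z, L Z = pComm X Y i Z
  | 0 => ⟨LinearMap.id, fun _ ↦ rfl⟩
  | 1 => ⟨LinearMap.mulRight K X - LinearMap.mulLeft K X, fun _ ↦ rfl⟩
  | i + 2 => by
    obtain ⟨L, hL⟩ := exists_linearMap_eq_pComm K X Y (i + 1)
    refine ⟨(LinearMap.mulRight K (L (Y ^ (i + 1))) -
      LinearMap.mulLeft K (L (Y ^ (i + 1)))).comp L, fun Z ↦ ?_⟩
    simp [pComm, hL]

theorem pComm_pow_eq_zero {R : Type*} [Ring R] (X Y : R) :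
    ∀ (i j : ℕ), j < i → pComm X Y i (Y ^ j) = 0
  | 0, _, h => absurd h (Nat.not_lt_zero _)
  | 1, j, h => by
    obtain rfl : j = 0 := by omega
    simp [pComm]
  | i + 2, j, h => by
    obtain rfl | hj := eq_or_lt_of_le (Nat.lt_succ_iff.1 h)
    · simp [pComm]
    · simp [pComm, pComm_pow_eq_zero X Y (i + 1) j hj]

open Polynomial in
/-- If `Y` is a root of a monic polynomial of degree at most `n`, then `p_n(X, Y; Y ^ k) = 0`. -/
theorem pComm_pow_eq_zero_of_aeval_eq_zero {K R : Type*} [Field K] [Ring R] [Algebra K R]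
    (X Y : R) {q : K[X]} (hq : q.Monic) (hY : aeval Y q = 0) {n : ℕ} (hn : q.degree ≤ n) (k : ℕ) :
    pComm X Y n (Y ^ k) = 0 := by
  obtain ⟨L, hL⟩ := exists_linearMap_eq_pComm K X Y n
  have hpow : Y ^ k = aeval Y ((Polynomial.X : K[X]) ^ k %ₘ q) := by
    rw [aeval_modByMonic_eq_self_of_root hY, map_pow, aeval_X]
  rw [← hL, hpow, aeval_eq_sum_range, map_sum]
  refine Finset.sum_eq_zero fun j _ ↦ ?_
  rw [map_smul, hL]
  by_cases hj : j < n
  · rw [pComm_pow_eq_zero X Y n j hj, smul_zero]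
  · rw [coeff_eq_zero_of_degree_lt, zero_smul]
    exact ((degree_modByMonic_lt _ hq).trans_le hn).trans_le
      (by exact_mod_cast not_lt.1 hj)

/-- Let `A` be a unital `ℂ`-algebra of at most countable dimension with finite PI degree
`n := PI.deg(A)`.  Then `p_n(a, b; b^n)` lies in the Jacobson radical `J(A)` for all
`a, b ∈ A`, i.e. it annihilates every simple left `A`-module. -/
theorem stmt10 (A : Type u) [Ring A] [Algebra ℂ A]
    (hcount : Module.rank ℂ A ≤ Cardinal.aleph0)
    (n : ℕ) (hn : PIdeg A = (n : ℕ∞)) (a b : A)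
    (V : Type u) [AddCommGroup V] [Module A V] (hV : IsSimpleModule A V) :
    ∀ v : V, pComm a b n (b ^ n) • v = 0 := by
  let _ : Module ℂ V := Module.compHom V (algebraMap ℂ A)
  have : IsScalarTower ℂ A V := ⟨fun c r v ↦ by
    rw [Algebra.smul_def, mul_smul]
    rfl⟩
  have hrank : Module.rank ℂ V ≤ n := by
    by_contra! hlt
    obtain ⟨e, he⟩ := (Module.le_rank_iff (n := n + 1)).1 (by
      simpa using Order.succ_le_of_lt hlt)
    have hle : ((n + 1 : ℕ) : ℕ∞) ≤ PIdeg A :=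
      le_iSup₂_of_le (n + 1) ⟨n.succ_pos, fun f hf ↦
        isPolyId_matrix_of_linearIndependent_s10 hcount he hf⟩ le_rfl
    rw [hn, Nat.cast_le] at hle
    omega
  have hfin : Module.Finite ℂ V :=
    Module.rank_lt_aleph0_iff.1 (hrank.trans_lt Cardinal.natCast_lt_aleph0)
  let ρ := Algebra.lsmul ℂ ℂ V (A := A)
  have hρ : ρ (pComm a b n (b ^ n)) = 0 := by
    have h := map_pComm ρ.toRingHom a b n (b ^ n)
    rw [map_pow] at h
    refine h.trans (pComm_pow_eq_zero_of_aeval_eq_zero _ _ (LinearMap.charpoly_monic (ρ b))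
      (LinearMap.aeval_self_charpoly (ρ b)) ?_ n)
    rw [Polynomial.degree_eq_natDegree (LinearMap.charpoly_monic (ρ b)).ne_zero,
      LinearMap.charpoly_natDegree]
    exact_mod_cast Module.finrank_le_of_rank_le hrank
  exact LinearMap.congr_fun hρ
end
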